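/- If α ≻ β coordinatewise (α₁ > β₁ and α₂ > β₂), then M(D_α) ⊆ M(D_β): every multiplier of D_α is a multiplier of D_β. -/

import Mathlib

open scoped BigOperators

/-- The open unit disc in ℂ. -/
def UnitDisc : Set ℂ := {z : ℂ | ‖z‖ < 1}

/-- The open unit bidisc in ℂ². -/
def UnitBidisc : Set (ℂ × ℂ) := {p : ℂ × ℂ | ‖p.1‖ < 1 ∧ ‖p.2‖ < 1}

/-- `a` is the double power series coefficient sequence of `f` on the bidisc. -/
def IsCoeff (f : ℂ × ℂ → ℂ) (a : ℕ → ℕ → ℂ) : Prop :=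
  ∀ p ∈ UnitBidisc,
    HasSum (fun kl : ℕ × ℕ => a kl.1 kl.2 * p.1 ^ kl.1 * p.2 ^ kl.2) (f p)

/-- Weighted squared-coefficient summand for the bidisc Dirichlet type space. -/
noncomputable def wt (a1 a2 : ℝ) (a : ℕ → ℕ → ℂ) (kl : ℕ × ℕ) : ℝ :=
  ‖a kl.1 kl.2‖ ^ 2 * ((kl.1 : ℝ) + 1) ^ a1 * ((kl.2 : ℝ) + 1) ^ a2

/-- Membership in the Dirichlet type space `D_{(a1,a2)}` on the bidisc. -/
def MemD (a1 a2 : ℝ) (f : ℂ × ℂ → ℂ) : Prop :=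
  ∃ a : ℕ → ℕ → ℂ, IsCoeff f a ∧ Summable (wt a1 a2 a)

/-- `b` is the power series coefficient sequence of `g` on the unit disc. -/
def IsCoeff1 (g : ℂ → ℂ) (b : ℕ → ℂ) : Prop :=
  ∀ z ∈ UnitDisc, HasSum (fun k : ℕ => b k * z ^ k) (g z)

/-- Weighted squared-coefficient summand for the one-variable Dirichlet type space. -/
noncomputable def wt1 (a : ℝ) (b : ℕ → ℂ) (k : ℕ) : ℝ :=
  ‖b k‖ ^ 2 * ((k : ℝ) + 1) ^ a

/-- Membership in the one-variable Dirichlet type space `D_a` on the unit disc. -/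
def MemD1 (a : ℝ) (g : ℂ → ℂ) : Prop :=
  ∃ b : ℕ → ℂ, IsCoeff1 g b ∧ Summable (wt1 a b)

/-- `φ` is a multiplier from `D_{(a1,a2)}` to `D_{(b1,b2)}` on the bidisc. -/
def MemM (a1 a2 b1 b2 : ℝ) (φ : ℂ × ℂ → ℂ) : Prop :=
  ∀ f : ℂ × ℂ → ℂ, MemD a1 a2 f → MemD b1 b2 (fun p => φ p * f p)

/-- `φ` is a multiplier from `D_a` to `D_b` on the unit disc. -/
def MemM1 (a b : ℝ) (φ : ℂ → ℂ) : Prop :=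
  ∀ g : ℂ → ℂ, MemD1 a g → MemD1 b (fun z => φ z * g z)

/-- The norm of the evaluation functional at `(z,w)` on `D_{(g1,g2)}`. -/
noncomputable def evalNorm (g1 g2 : ℝ) (z w : ℂ) : ℝ :=
  Real.sqrt (∑' kl : ℕ × ℕ,
    ‖z‖ ^ (2 * kl.1) * ‖w‖ ^ (2 * kl.2) *
      ((kl.1 : ℝ) + 1) ^ (-g1) * ((kl.2 : ℝ) + 1) ^ (-g2))


open Filter Topology in
/-- An operator on sequences that maps a weighted `ℓ²` space into itself is bounded there. -/
theorem exists_weighted_bound {ι : Type*} (L : (ι → ℂ) →L[ℂ] (ι → ℂ)) (w : ι → ℝ)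
    (hw : ∀ i, 0 < w i)
    (hL : ∀ a : ι → ℂ, Summable (fun i => ‖a i‖ ^ 2 * w i) →
      Summable (fun i => ‖L a i‖ ^ 2 * w i)) :
    ∃ C : ℝ, 0 ≤ C ∧ ∀ a : ι → ℂ, Summable (fun i => ‖a i‖ ^ 2 * w i) →
      ∑' i, ‖L a i‖ ^ 2 * w i ≤ C * ∑' i, ‖a i‖ ^ 2 * w i := by
  set s : ι → ℂ := fun i => ((√(w i) : ℝ) : ℂ) with hs
  have hs0 : ∀ i, s i ≠ 0 := fun i => by
    simpa [hs] using (Real.sqrt_pos.2 (hw i)).ne'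
  have hsn : ∀ i, ‖s i‖ ^ 2 = w i := fun i => by
    rw [hs, Complex.norm_real, Real.norm_eq_abs, sq_abs, Real.sq_sqrt (hw i).le]
  have hmem : ∀ x : ι → ℂ, Memℓp x 2 ↔ Summable fun i => ‖x i‖ ^ 2 := fun x => by
    rw [memℓp_gen_iff (by norm_num)]; simp
  have hnorm : ∀ x : lp (fun _ : ι => ℂ) 2, ‖x‖ ^ 2 = ∑' i, ‖x i‖ ^ 2 := fun x => by
    simpa using lp.norm_rpow_eq_tsum (p := 2) (by norm_num) x
  let D : (ι → ℂ) → ι → ℂ := fun x i => (s i)⁻¹ * x i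
  have hD : ∀ (x : ι → ℂ) i, ‖D x i‖ ^ 2 * w i = ‖x i‖ ^ 2 := fun x i => by
    have := (hw i).ne'
    simp only [D, norm_mul, norm_inv, mul_pow, inv_pow, hsn]
    field_simp
  have hE : ∀ (x : ι → ℂ) i, ‖s i * x i‖ ^ 2 = ‖x i‖ ^ 2 * w i := fun x i => by
    rw [norm_mul, mul_pow, hsn, mul_comm]
  have hS : ∀ x : lp (fun _ : ι => ℂ) 2, Memℓp (fun i => s i * L (D x) i) 2 := fun x => by
    rw [hmem]
    simp only [hE]
    apply hL
    simp only [hD]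
    exact (hmem x).1 (lp.memℓp x)
  let S : lp (fun _ : ι => ℂ) 2 →ₗ[ℂ] lp (fun _ : ι => ℂ) 2 :=
    { toFun := fun x => ⟨fun i => s i * L (D x) i, hS x⟩
      map_add' := fun x y => by
        ext i
        have : D (⇑(x + y)) = D x + D y := by
          ext j; simp [D, mul_add]
        change s i * L (D (⇑(x + y))) i = s i * L (D x) i + s i * L (D y) i
        rw [this, map_add, Pi.add_apply, mul_add]
      map_smul' := fun r x => by
        ext i
        have : D (⇑(r • x)) = r • D x := by
          ext j; simp [D, mul_left_comm]
        change s i * L (D (⇑(r • x))) i = r * (s i * L (D x) i)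
        rw [this, map_smul, Pi.smul_apply, smul_eq_mul, mul_left_comm] }
  have hcoord : ∀ (i : ι) (u : ℕ → lp (fun _ : ι => ℂ) 2) (x : lp (fun _ : ι => ℂ) 2),
      Tendsto u atTop (𝓝 x) → Tendsto (fun n => u n i) atTop (𝓝 (x i)) := fun i u x h =>
    ((lp.evalCLM ℂ (fun _ : ι => ℂ) 2 i).continuous.tendsto x).comp h
  have hcont : Continuous S := S.continuous_of_seq_closed_graph fun u x y hu hSu => by
    ext i
    have h1 : Tendsto (fun n => D (u n)) atTop (𝓝 (D x)) :=
      tendsto_pi_nhds.2 fun j => (hcoord j u x hu).const_mul _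
    have h2 := (tendsto_pi_nhds.1 ((L.continuous.tendsto _).comp h1) i).const_mul (s i)
    exact tendsto_nhds_unique (hcoord i _ y hSu) h2
  let S' : lp (fun _ : ι => ℂ) 2 →L[ℂ] lp (fun _ : ι => ℂ) 2 := ⟨S, hcont⟩
  refine ⟨‖S'‖ ^ 2, by positivity, fun a ha => ?_⟩
  have hx : Memℓp (fun i => s i * a i) 2 := by
    rw [hmem]; simpa only [hE] using ha
  let x : lp (fun _ : ι => ℂ) 2 := ⟨fun i => s i * a i, hx⟩
  have hDx : D x = a := by
    ext i; simp [D, x, hs0]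
  have h := pow_le_pow_left₀ (norm_nonneg _) (S'.le_opNorm x) 2
  rw [mul_pow, hnorm, hnorm] at h
  have e1 : ∀ i, ‖S' x i‖ ^ 2 = ‖L a i‖ ^ 2 * w i := fun i => by
    rw [← hE, ← hDx]; rfl
  have e2 : ∀ i, ‖x i‖ ^ 2 = ‖a i‖ ^ 2 * w i := fun i => hE a i
  simpa only [e1, e2] using h

/-- A triangular operator that preserves a weighted `ℓ²` space also preserves the space obtained
by dividing the weight by an increasing function of the grading `ρ`. -/
theorem summable_weighted_of_triangular {ι : Type*} (L : (ι → ℂ) →L[ℂ] (ι → ℂ)) (ρ : ι → ℕ)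
    (htri : ∀ n, ∀ a b : ι → ℂ, (∀ m, ρ m ≤ ρ n → a m = b m) → L a n = L b n)
    (w : ι → ℝ) (hw : ∀ i, 0 < w i) (q : ℕ → ℝ) (hq : ∀ j, 0 ≤ q j) (R : ℕ → ℝ)
    (hR : ∀ n, R n = ∑ j ∈ Finset.range (n + 1), q j) (hR0 : ∀ n, 0 < R n)
    (hL : ∀ a : ι → ℂ, Summable (fun i => ‖a i‖ ^ 2 * w i) →
      Summable (fun i => ‖L a i‖ ^ 2 * w i))
    (a : ι → ℂ) (ha : Summable fun i => ‖a i‖ ^ 2 * (w i / R (ρ i))) :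
    Summable fun i => ‖L a i‖ ^ 2 * (w i / R (ρ i)) := by
  obtain ⟨C, hC, hb⟩ := exists_weighted_bound L w hw hL
  let g : ℕ → ι → ℂ := fun j m =>
    if j ≤ ρ m then ((√(q j) / R (ρ m) : ℝ) : ℂ) * a m else 0
  have hg : ∀ j m, ‖g j m‖ ^ 2 * w m =
      (if j ≤ ρ m then q j else 0) / R (ρ m) * (‖a m‖ ^ 2 * (w m / R (ρ m))) := fun j m => by
    have := (hR0 (ρ m)).ne'
    by_cases h : j ≤ ρ m
    · simp only [g, h, if_true, norm_mul, Complex.norm_real, Real.norm_eq_abs, mul_pow, sq_abs,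
        div_pow, Real.sq_sqrt (hq j)]
      field_simp
    · simp [g, h]
  have hsum_if : ∀ m N, ∑ j ∈ Finset.range (N + 1), (if j ≤ ρ m then q j else 0) ≤ R (ρ m) := by
    intro m N
    rw [← Finset.sum_filter, hR]
    refine Finset.sum_le_sum_of_subset_of_nonneg (fun j hj => ?_) fun j _ _ => hq j
    simp only [Finset.mem_filter, Finset.mem_range] at hj ⊢
    omega
  have hif : ∀ j m, (if j ≤ ρ m then q j else 0) ≤ R (ρ m) := fun j m =>
    (Finset.single_le_sum (f := fun j => if j ≤ ρ m then q j else 0)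
      (fun i _ => by split_ifs <;> simp [hq]) (Finset.self_mem_range_succ j)).trans
      (hsum_if m j)
  have hgs : ∀ j, Summable fun m => ‖g j m‖ ^ 2 * w m := fun j => by
    refine Summable.of_nonneg_of_le (fun m => mul_nonneg (sq_nonneg _) (hw m).le)
      (fun m => ?_) ha
    rw [hg]
    refine mul_le_of_le_one_left ?_ ((div_le_one (hR0 _)).2 (hif j m))
    exact mul_nonneg (sq_nonneg _) (div_pos (hw m) (hR0 _)).le
  have hdecomp : ∀ n, L a n = ∑ j ∈ Finset.range (ρ n + 1), ((√(q j) : ℝ) : ℂ) * L (g j) n := by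
    intro n
    have : L a n = L (∑ j ∈ Finset.range (ρ n + 1), ((√(q j) : ℝ) : ℂ) • g j) n := by
      refine htri n _ _ fun m hm => ?_
      have h1 : ∀ j, ((√(q j) : ℝ) : ℂ) * g j m =
          (((if j ≤ ρ m then q j else 0) : ℝ) : ℂ) * (((R (ρ m))⁻¹ : ℝ) * a m) := fun j => by
        by_cases h : j ≤ ρ m
        · simp only [g, h, if_true]
          rw [← mul_assoc, ← mul_assoc, ← Complex.ofReal_mul, ← Complex.ofReal_mul,
            ← mul_div_assoc, Real.mul_self_sqrt (hq j), div_eq_mul_inv]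
        · simp [g, h]
      have h2 : ∑ j ∈ Finset.range (ρ n + 1), (if j ≤ ρ m then q j else 0) = R (ρ m) := by
        rw [← Finset.sum_filter, hR]
        congr 1
        ext j
        simp only [Finset.mem_filter, Finset.mem_range]
        omega
      have h3 : (R (ρ m) : ℂ) ≠ 0 := by exact_mod_cast (hR0 (ρ m)).ne'
      simp only [Finset.sum_apply, Pi.smul_apply, smul_eq_mul, h1]
      rw [← Finset.sum_mul, ← Complex.ofReal_sum, h2, Complex.ofReal_inv, mul_inv_cancel_left₀ h3]
    rw [this, map_sum]
    simp [Finset.sum_apply]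
  have hpt : ∀ n N, ρ n ≤ N →
      ‖L a n‖ ^ 2 * (w n / R (ρ n)) ≤ ∑ j ∈ Finset.range (N + 1), ‖L (g j) n‖ ^ 2 * w n := by
    intro n N hN
    have h1 : ‖L a n‖ ≤ ∑ j ∈ Finset.range (ρ n + 1), √(q j) * ‖L (g j) n‖ := by
      rw [hdecomp]
      refine (norm_sum_le _ _).trans_eq (Finset.sum_congr rfl fun j _ => ?_)
      rw [norm_mul, Complex.norm_real, Real.norm_of_nonneg (Real.sqrt_nonneg _)]
    have h2 : ‖L a n‖ ^ 2 ≤ R (ρ n) * ∑ j ∈ Finset.range (ρ n + 1), ‖L (g j) n‖ ^ 2 := by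
      refine (pow_le_pow_left₀ (norm_nonneg _) h1 2).trans ?_
      refine (Finset.sum_mul_sq_le_sq_mul_sq _ _ _).trans_eq ?_
      rw [hR]
      simp only [Real.sq_sqrt (hq _)]
    have h3 : ∑ j ∈ Finset.range (ρ n + 1), ‖L (g j) n‖ ^ 2 ≤
        ∑ j ∈ Finset.range (N + 1), ‖L (g j) n‖ ^ 2 :=
      Finset.sum_le_sum_of_subset_of_nonneg (Finset.range_mono (by omega)) fun _ _ _ => sq_nonneg _
    have h4 := (hR0 (ρ n))
    calc ‖L a n‖ ^ 2 * (w n / R (ρ n))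
        ≤ (R (ρ n) * ∑ j ∈ Finset.range (N + 1), ‖L (g j) n‖ ^ 2) * (w n / R (ρ n)) :=
          mul_le_mul_of_nonneg_right (h2.trans (mul_le_mul_of_nonneg_left h3 h4.le))
            (div_pos (hw n) h4).le
      _ = ∑ j ∈ Finset.range (N + 1), ‖L (g j) n‖ ^ 2 * w n := by
          rw [← Finset.sum_mul]; field_simp
  refine summable_of_sum_le (c := C * ∑' i, ‖a i‖ ^ 2 * (w i / R (ρ i)))
    (fun n => mul_nonneg (sq_nonneg _) (div_pos (hw n) (hR0 _)).le) fun s => ?_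
  let N := s.sup ρ
  calc ∑ n ∈ s, ‖L a n‖ ^ 2 * (w n / R (ρ n))
      ≤ ∑ n ∈ s, ∑ j ∈ Finset.range (N + 1), ‖L (g j) n‖ ^ 2 * w n :=
        Finset.sum_le_sum fun n hn => hpt n N (Finset.le_sup hn)
    _ = ∑ j ∈ Finset.range (N + 1), ∑ n ∈ s, ‖L (g j) n‖ ^ 2 * w n := Finset.sum_comm
    _ ≤ ∑ j ∈ Finset.range (N + 1), C * ∑' m, ‖g j m‖ ^ 2 * w m :=
        Finset.sum_le_sum fun j _ => ((hL _ (hgs j)).sum_le_tsum s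
          fun n _ => mul_nonneg (sq_nonneg _) (hw n).le).trans (hb _ (hgs j))
    _ = C * ∑' m, ∑ j ∈ Finset.range (N + 1), ‖g j m‖ ^ 2 * w m := by
        rw [← Finset.mul_sum, Summable.tsum_finsetSum fun j _ => hgs j]
    _ ≤ C * ∑' i, ‖a i‖ ^ 2 * (w i / R (ρ i)) := by
        refine mul_le_mul_of_nonneg_left
          (Summable.tsum_le_tsum (fun m => ?_) (summable_sum fun j _ => hgs j) ha) hC
        simp only [hg]
        rw [← Finset.sum_mul, ← Finset.sum_div]
        refine mul_le_of_le_one_left ?_ ((div_le_one (hR0 _)).2 (hsum_if m N))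
        exact mul_nonneg (sq_nonneg _) (div_pos (hw m) (hR0 _)).le

instance instHasAntidiagonalNatProd : Finset.HasAntidiagonal (ℕ × ℕ) where
  antidiagonal n := {uv ∈ Finset.Iic n ×ˢ Finset.Iic n | uv.1 + uv.2 = n}
  mem_antidiagonal {n} {a} := by
    simp only [Finset.mem_filter, and_iff_right_iff_imp]
    intro h
    simp [← h]

/-- The Cauchy product with a fixed double sequence `c`, as a continuous operator on double
sequences. -/
noncomputable def cauchyProd (c : ℕ × ℕ → ℂ) : (ℕ × ℕ → ℂ) →L[ℂ] (ℕ × ℕ → ℂ) :=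
  ContinuousLinearMap.pi fun n =>
    ∑ p ∈ Finset.HasAntidiagonal.antidiagonal n, c p.1 • ContinuousLinearMap.proj p.2

theorem cauchyProd_apply (c a : ℕ × ℕ → ℂ) (n : ℕ × ℕ) :
    cauchyProd c a n = ∑ p ∈ Finset.HasAntidiagonal.antidiagonal n, c p.1 * a p.2 := by
  simp [cauchyProd]

theorem cauchyProd_congr (c : ℕ × ℕ → ℂ) {a b : ℕ × ℕ → ℂ} {n : ℕ × ℕ}
    (h : ∀ m ≤ n, a m = b m) : cauchyProd c a n = cauchyProd c b n := by
  rw [cauchyProd_apply, cauchyProd_apply]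
  refine Finset.sum_congr rfl fun p hp => ?_
  rw [h p.2 (by rw [← Finset.HasAntidiagonal.mem_antidiagonal.1 hp]; exact le_add_self)]

theorem HasSum.mul_antidiagonal {A : Type*} [AddCommMonoid A] [Finset.HasAntidiagonal A]
    {f g : A → ℂ} {x y : ℂ} (hf : HasSum f x) (hg : HasSum g y) :
    HasSum (fun n => ∑ q ∈ Finset.HasAntidiagonal.antidiagonal n, f q.1 * g q.2) (x * y) := by
  have hmul : Summable fun q : A × A => f q.1 * g q.2 :=
    summable_mul_of_summable_norm hf.summable.norm hg.summable.norm
  have hsum := (summable_sum_mul_antidiagonal_of_summable_mul (f := f) (g := g) hmul).hasSum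
  rwa [← hf.summable.tsum_mul_tsum_eq_tsum_sum_antidiagonal hg.summable hmul, hf.tsum_eq,
    hg.tsum_eq] at hsum

theorem hasSum_cauchyProd {c a : ℕ × ℕ → ℂ} {z w x y : ℂ}
    (hc : HasSum (fun m : ℕ × ℕ => c m * z ^ m.1 * w ^ m.2) x)
    (ha : HasSum (fun m : ℕ × ℕ => a m * z ^ m.1 * w ^ m.2) y) :
    HasSum (fun m : ℕ × ℕ => cauchyProd c a m * z ^ m.1 * w ^ m.2) (x * y) := by
  have hterm : ∀ n : ℕ × ℕ, cauchyProd c a n * z ^ n.1 * w ^ n.2 =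
      ∑ q ∈ Finset.HasAntidiagonal.antidiagonal n,
        c q.1 * z ^ q.1.1 * w ^ q.1.2 * (a q.2 * z ^ q.2.1 * w ^ q.2.2) := fun n => by
    rw [cauchyProd_apply, Finset.sum_mul, Finset.sum_mul]
    refine Finset.sum_congr rfl fun q hq => ?_
    rw [← Finset.HasAntidiagonal.mem_antidiagonal.1 hq, Prod.fst_add, Prod.snd_add, pow_add,
      pow_add]
    ring
  exact (hc.mul_antidiagonal ha).congr_fun hterm

theorem IsCoeff.mul {f g : ℂ × ℂ → ℂ} {c a : ℕ × ℕ → ℂ} (hf : IsCoeff f (Function.curry c))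
    (hg : IsCoeff g (Function.curry a)) :
    IsCoeff (fun p => f p * g p) (Function.curry (cauchyProd c a)) :=
  fun p hp => hasSum_cauchyProd (hf p hp) (hg p hp)

theorem eq_zero_of_hasSum_pow {b : ℕ → ℂ}
    (h : ∀ z : ℂ, ‖z‖ < 1 → HasSum (fun k => b k * z ^ k) 0) : b = 0 := by
  have h1 : HasFPowerSeriesAt (0 : ℂ → ℂ) (FormalMultilinearSeries.ofScalars ℂ b) 0 := by
    rw [hasFPowerSeriesAt_iff]
    filter_upwards [Metric.ball_mem_nhds (0 : ℂ) one_pos] with z hz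
    simpa [mul_comm] using h z (by simpa using hz)
  ext n
  simpa using h1.apply_eq_zero n 1

theorem IsCoeff.unique {f : ℂ × ℂ → ℂ} {a b : ℕ → ℕ → ℂ} (ha : IsCoeff f a)
    (hb : IsCoeff f b) : a = b := by
  let d : ℕ → ℕ → ℂ := a - b
  have hd : ∀ z w : ℂ, ‖z‖ < 1 → ‖w‖ < 1 →
      HasSum (fun kl : ℕ × ℕ => d kl.1 kl.2 * z ^ kl.1 * w ^ kl.2) 0 := fun z w hz hw => by
    simpa [d, sub_mul] using (ha (z, w) ⟨hz, hw⟩).sub (hb (z, w) ⟨hz, hw⟩)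
  have hfib : ∀ (k : ℕ) (w : ℂ), ‖w‖ < 1 → Summable fun l => d k l * w ^ l := fun k w hw => by
    have h1 := (hd (1 / 2) w (by norm_num) hw).summable.prod_factor k
    have h2 : ((1 / 2 : ℂ)) ^ k ≠ 0 := by simp
    refine (summable_mul_left_iff h2).1 (h1.congr fun l => ?_)
    ring
  have hrow : ∀ w : ℂ, ‖w‖ < 1 → (fun k => ∑' l, d k l * w ^ l) = 0 := fun w hw =>
    eq_zero_of_hasSum_pow fun z hz => (hd z w hz hw).prod_fiberwise fun k => by
      refine ((hfib k w hw).hasSum.mul_right (z ^ k)).congr_fun fun l => ?_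
      ring
  have hzero : ∀ k, d k = 0 := fun k => eq_zero_of_hasSum_pow fun w hw => by
    have := (hfib k w hw).hasSum
    rwa [congrFun (hrow w hw) k] at this
  exact sub_eq_zero.1 (funext hzero)

theorem summable_geometric_mul_rpow {r : ℝ} (hr0 : 0 ≤ r) (hr1 : r < 1) (s : ℝ) :
    Summable fun k : ℕ => (r ^ k) ^ 2 * ((k : ℝ) + 1) ^ s := by
  obtain ⟨N, hN⟩ := exists_nat_ge s
  have hx : ‖r ^ 2‖ < 1 := by
    rw [Real.norm_of_nonneg (by positivity)]
    exact pow_lt_one₀ hr0 hr1 two_ne_zero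
  have hg := (summable_pow_mul_geometric_of_norm_lt_one N hx).add
    (summable_geometric_of_norm_lt_one hx)
  refine Summable.of_nonneg_of_le (fun k => by positivity) (fun k => ?_)
    (hg.mul_left ((2 : ℝ) ^ (N - 1)))
  have h1 : ((k : ℝ) + 1) ^ s ≤ 2 ^ (N - 1) * ((k : ℝ) ^ N + 1) := by
    calc ((k : ℝ) + 1) ^ s ≤ ((k : ℝ) + 1) ^ (N : ℝ) :=
          Real.rpow_le_rpow_of_exponent_le (by simp) hN
      _ = ((k : ℝ) + 1) ^ N := Real.rpow_natCast _ _
      _ ≤ 2 ^ (N - 1) * ((k : ℝ) ^ N + 1) := by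
          simpa using add_pow_le (Nat.cast_nonneg (α := ℝ) k) zero_le_one N
  calc (r ^ k) ^ 2 * ((k : ℝ) + 1) ^ s
      ≤ (r ^ k) ^ 2 * (2 ^ (N - 1) * ((k : ℝ) ^ N + 1)) := by gcongr
    _ = 2 ^ (N - 1) * ((k : ℝ) ^ N * (r ^ 2) ^ k + (r ^ 2) ^ k) := by
        rw [← pow_mul, ← pow_mul, mul_comm k 2]; ring

/-- A double sequence in a weighted `ℓ²` space is the coefficient sequence of a function on the
bidisc. -/
theorem isCoeff_tsum_of_summable_wt {a1 a2 : ℝ} {a : ℕ → ℕ → ℂ} (ha : Summable (wt a1 a2 a)) :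
    IsCoeff (fun p => ∑' kl : ℕ × ℕ, a kl.1 kl.2 * p.1 ^ kl.1 * p.2 ^ kl.2) a := by
  rintro ⟨z, w⟩ ⟨hz, hw⟩
  refine Summable.hasSum (Summable.of_norm_bounded (ha.add
    ((summable_geometric_mul_rpow (norm_nonneg z) hz (-a1)).mul_of_nonneg
      (summable_geometric_mul_rpow (norm_nonneg w) hw (-a2))
      (fun k => by positivity) (fun k => by positivity))) fun kl => ?_)
  obtain ⟨k, l⟩ := kl
  simp only [wt, norm_mul, norm_pow]
  have hk : (0 : ℝ) < (k : ℝ) + 1 := by positivity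
  have hl : (0 : ℝ) < (l : ℝ) + 1 := by positivity
  rw [Real.rpow_neg hk.le, Real.rpow_neg hl.le]
  have hu : 0 < ((k : ℝ) + 1) ^ a1 * ((l : ℝ) + 1) ^ a2 := by positivity
  set u := ((k : ℝ) + 1) ^ a1 * ((l : ℝ) + 1) ^ a2 with hu_def
  have hy : 0 ≤ ‖a k l‖ * (‖z‖ ^ k * ‖w‖ ^ l) := by positivity
  have key : 2 * (‖a k l‖ * (‖z‖ ^ k * ‖w‖ ^ l)) ≤
      ‖a k l‖ ^ 2 * u + (‖z‖ ^ k * ‖w‖ ^ l) ^ 2 * u⁻¹ := by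
    have h1 := two_mul_le_add_sq (‖a k l‖ * √u) ((‖z‖ ^ k * ‖w‖ ^ l) * (√u)⁻¹)
    have h2 : √u ≠ 0 := (Real.sqrt_pos.2 hu).ne'
    rw [mul_pow, mul_pow, inv_pow, Real.sq_sqrt hu.le] at h1
    refine le_trans (le_of_eq ?_) h1
    field_simp
  calc ‖a k l‖ * ‖z‖ ^ k * ‖w‖ ^ l ≤ 2 * (‖a k l‖ * (‖z‖ ^ k * ‖w‖ ^ l)) := by linarith
    _ ≤ _ := key
    _ = _ := by rw [hu_def, mul_inv]; ring

theorem memM_self_iff {a1 a2 : ℝ} {φ : ℂ × ℂ → ℂ} {c : ℕ × ℕ → ℂ}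
    (hc : IsCoeff φ (Function.curry c)) :
    MemM a1 a2 a1 a2 φ ↔ ∀ a : ℕ × ℕ → ℂ, Summable (wt a1 a2 (Function.curry a)) →
      Summable (wt a1 a2 (Function.curry (cauchyProd c a))) := by
  constructor
  · intro h a ha
    have hf := isCoeff_tsum_of_summable_wt ha
    obtain ⟨b, hb, hbs⟩ := h _ ⟨_, hf, ha⟩
    rwa [(hc.mul hf).unique hb]
  · rintro h f ⟨a, hf, ha⟩
    exact ⟨_, hc.mul (a := Function.uncurry a) hf, h _ ha⟩

theorem memD_one (a1 a2 : ℝ) : MemD a1 a2 fun _ => 1 := by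
  refine ⟨fun k l => if (k, l) = ((0, 0) : ℕ × ℕ) then 1 else 0, fun p _ => ?_, ?_⟩
  · have := hasSum_ite_eq ((0, 0) : ℕ × ℕ) (1 : ℂ)
    refine this.congr_fun fun kl => ?_
    split_ifs with h <;> simp [h]
  · refine summable_of_ne_finset_zero (s := {((0, 0) : ℕ × ℕ)}) fun kl h => ?_
    have h' : kl ≠ (0, 0) := by simpa using h
    simp [wt, h']

/-- The increments of `k ↦ k ^ δ` add up to the weight `(k + 1) ^ δ`. -/
theorem sum_range_rpow_increment {δ : ℝ} (hδ : 0 < δ) (n : ℕ) :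
    ((n : ℝ) + 1) ^ δ =
      ∑ j ∈ Finset.range (n + 1), (((j : ℝ) + 1) ^ δ - (j : ℝ) ^ δ) := by
  have := Finset.sum_range_sub (fun j : ℕ => (j : ℝ) ^ δ) (n + 1)
  push_cast at this
  rw [this, Real.zero_rpow hδ.ne', sub_zero]

theorem summable_div_rpow_of_triangular {ι : Type*} (L : (ι → ℂ) →L[ℂ] (ι → ℂ)) (ρ : ι → ℕ)
    (htri : ∀ n, ∀ a b : ι → ℂ, (∀ m, ρ m ≤ ρ n → a m = b m) → L a n = L b n)
    (w : ι → ℝ) (hw : ∀ i, 0 < w i) {δ : ℝ} (hδ : 0 < δ)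
    (hL : ∀ a : ι → ℂ, Summable (fun i => ‖a i‖ ^ 2 * w i) →
      Summable (fun i => ‖L a i‖ ^ 2 * w i))
    (a : ι → ℂ) (ha : Summable fun i => ‖a i‖ ^ 2 * (w i / ((ρ i : ℝ) + 1) ^ δ)) :
    Summable fun i => ‖L a i‖ ^ 2 * (w i / ((ρ i : ℝ) + 1) ^ δ) :=
  summable_weighted_of_triangular L ρ htri w hw
    (fun j => ((j : ℝ) + 1) ^ δ - (j : ℝ) ^ δ)
    (fun j => sub_nonneg.2 (Real.rpow_le_rpow (by positivity) (by linarith) hδ.le))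
    (fun n => ((n : ℝ) + 1) ^ δ) (sum_range_rpow_increment hδ) (fun n => by positivity) hL a ha

/-- if `α ≻ β` then `M(D_α) ⊆ M(D_β)`. -/
theorem stmt14 (a1 a2 b1 b2 : ℝ) (h1 : b1 < a1) (h2 : b2 < a2)
    (φ : ℂ × ℂ → ℂ) (hφ : MemM a1 a2 a1 a2 φ) :
    MemM b1 b2 b1 b2 φ := by
  have hφ1 := hφ _ (memD_one a1 a2)
  simp only [mul_one] at hφ1
  obtain ⟨c', hc', -⟩ := hφ1
  obtain ⟨c, rfl⟩ : ∃ c, c' = Function.curry c := ⟨Function.uncurry c', rfl⟩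
  rw [memM_self_iff hc'] at hφ ⊢
  intro a ha
  have hwt : ∀ (s t : ℝ) (x : ℕ × ℕ → ℂ), wt s t (Function.curry x) =
      fun i => ‖x i‖ ^ 2 * (((i.1 : ℝ) + 1) ^ s * ((i.2 : ℝ) + 1) ^ t) := fun s t x => by
    ext i; simp [wt, mul_assoc]
  have hfst : ∀ (t : ℝ) (i : ℕ × ℕ), ((i.1 : ℝ) + 1) ^ b1 * ((i.2 : ℝ) + 1) ^ t =
      ((i.1 : ℝ) + 1) ^ a1 * ((i.2 : ℝ) + 1) ^ t / ((i.1 : ℝ) + 1) ^ (a1 - b1) := fun t i => by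
    rw [Real.rpow_sub (by positivity)]; field_simp
  have hsnd : ∀ (s : ℝ) (i : ℕ × ℕ), ((i.1 : ℝ) + 1) ^ s * ((i.2 : ℝ) + 1) ^ b2 =
      ((i.1 : ℝ) + 1) ^ s * ((i.2 : ℝ) + 1) ^ a2 / ((i.2 : ℝ) + 1) ^ (a2 - b2) := fun s i => by
    rw [Real.rpow_sub (by positivity)]; field_simp
  simp only [hwt] at hφ ha ⊢
  simp only [hsnd] at ha ⊢
  refine summable_div_rpow_of_triangular (cauchyProd c) Prod.snd
    (fun n x y h => cauchyProd_congr c fun m hm => h m hm.2) _ (fun i => by positivity)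
    (sub_pos.2 h2) (fun x hx => ?_) a ha
  simp only [hfst] at hx ⊢
  exact summable_div_rpow_of_triangular (cauchyProd c) Prod.fst
    (fun n x y h => cauchyProd_congr c fun m hm => h m hm.1) _ (fun i => by positivity)
    (sub_pos.2 h1) hφ x hx
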